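/- There are exactly 16 cosets u+M of order 2 in M^∨/M satisfying τ(u) + M = u + M and admitting a representative u ∈ M^∨ with B(u,u) = 1; one of them is the coset of (0, 0, 1/2, 1/2, 0, 0), so exactly 15 of them are different from the coset of (0, 0, 1/2, 1/2, 0, 0). -/

import Mathlib

open Matrix

noncomputable section

/-- Gram matrix of the even lattice `2U(2) ⊕ 2A₁`. -/
def GramC : Matrix (Fin 6) (Fin 6) ℚ :=
  !![0,0,0,0,0,2; 0,0,0,0,2,0; 0,0,2,0,0,0; 0,0,0,2,0,0; 0,2,0,0,0,0; 2,0,0,0,0,0]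

/-- The bilinear form on `V = ℚ⁶` with Gram matrix `GramC`. -/
def BC (x y : Fin 6 → ℚ) : ℚ := x ⬝ᵥ GramC.mulVec y

/-- The lattice `M = ℤ⁶ ⊆ ℚ⁶`. -/
def MC : AddSubgroup (Fin 6 → ℚ) where
  carrier := {x | ∀ i, ∃ n : ℤ, x i = (n : ℚ)}
  zero_mem' := fun i => ⟨0, by simp⟩
  add_mem' := by
    intro a b ha hb i
    obtain ⟨n, hn⟩ := ha i
    obtain ⟨m, hm⟩ := hb i
    exact ⟨n + m, by simp [hn, hm]⟩
  neg_mem' := by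
    intro a ha i
    obtain ⟨n, hn⟩ := ha i
    exact ⟨-n, by simp [hn]⟩

/-- The dual lattice `M^∨ = {x ∈ V : B(x,m) ∈ ℤ for all m ∈ M}`. -/
def MCdual : Set (Fin 6 → ℚ) := {x | ∀ m ∈ MC, ∃ n : ℤ, BC x m = (n : ℚ)}

/-- The quotient `V/M` (containing the discriminant group `M^∨/M`). -/
abbrev QC := (Fin 6 → ℚ) ⧸ MC

/-- The projection `V → V/M`. -/
def pC : (Fin 6 → ℚ) → QC := QuotientAddGroup.mk

/-- The isometry `τ` swapping the two `A₁` components (the 3rd and 4th standard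
coordinates). -/
def tauC (x : Fin 6 → ℚ) : Fin 6 → ℚ := fun i => x (Equiv.swap (2 : Fin 6) 3 i)

/-- The cosets of order 2 in `M^∨/M` fixed by `τ` and admitting a representative of
norm `B(u,u) = 1`. -/
def T16 : Set QC :=
  {c | ∃ u : Fin 6 → ℚ, u ∈ MCdual ∧ pC u = c ∧ addOrderOf c = 2 ∧
    pC (tauC u) = c ∧ BC u u = 1}

/-- Half of a 0/1 vector. -/
def halfC (e : Fin 6 → Fin 2) : Fin 6 → ℚ := fun i => ((e i : ℕ) : ℚ) / 2

/-- Index set of the 16 cosets. -/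
def EC : Finset (Fin 6 → Fin 2) :=
  Finset.univ.filter fun e => e 2 = e 3 ∧ e 0 * e 5 + e 1 * e 4 + e 2 = 1

theorem EC_card : EC.card = 16 := by decide +kernel

theorem BC_eq (x y : Fin 6 → ℚ) : BC x y =
    2 * (x 0 * y 5 + x 1 * y 4 + x 2 * y 2 + x 3 * y 3 + x 4 * y 1 + x 5 * y 0) := by
  simp [BC, GramC, dotProduct, Matrix.mulVec, Fin.sum_univ_six]
  ring

theorem pC_eq (x y : Fin 6 → ℚ) : pC x = pC y ↔ ∀ i, ∃ n : ℤ, y i - x i = n := by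
  unfold pC
  rw [QuotientAddGroup.eq]
  show (∀ i, ∃ n : ℤ, (-x + y) i = n) ↔ _
  simp only [Pi.add_apply, Pi.neg_apply, neg_add_eq_sub]

theorem halfC_inj : Function.Injective (fun e => pC (halfC e)) := by
  intro e f h
  funext i
  obtain ⟨n, hn⟩ := (pC_eq _ _).1 h i
  simp only [halfC] at hn
  have h2 : ((f i : ℕ) : ℤ) - (e i : ℕ) = 2 * n := by
    have : (((f i : ℕ) : ℚ)) - (e i : ℕ) = 2 * n := by linarith
    exact_mod_cast this
  have := (f i).2
  have := (e i).2
  apply Fin.ext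
  omega

theorem dual_half (u : Fin 6 → ℚ) (h : u ∈ MCdual) : ∀ i, ∃ n : ℤ, u i = n / 2 := by
  have key : ∀ j : Fin 6, ∃ n : ℤ, BC u (Pi.single j 1) = n := by
    intro j
    apply h
    intro i
    by_cases hij : i = j
    · subst hij; exact ⟨1, by simp⟩
    · exact ⟨0, by simp [hij]⟩
  simp only [BC_eq] at key
  intro i
  obtain ⟨n0, h0⟩ := key 0
  obtain ⟨n1, h1⟩ := key 1
  obtain ⟨n2, h2⟩ := key 2
  obtain ⟨n3, h3⟩ := key 3
  obtain ⟨n4, h4⟩ := key 4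
  obtain ⟨n5, h5⟩ := key 5
  simp [Pi.single_apply] at h0 h1 h2 h3 h4 h5
  fin_cases i
  · exact ⟨n5, by simp; linarith⟩
  · exact ⟨n4, by simp; linarith⟩
  · exact ⟨n2, by simp; linarith⟩
  · exact ⟨n3, by simp; linarith⟩
  · exact ⟨n1, by simp; linarith⟩
  · exact ⟨n0, by simp; linarith⟩

theorem half_dual (u : Fin 6 → ℚ) (a : Fin 6 → ℤ) (h : ∀ i, u i = a i / 2) : u ∈ MCdual := by
  intro m hm
  choose b hb using hm
  refine ⟨a 0 * b 5 + a 1 * b 4 + a 2 * b 2 + a 3 * b 3 + a 4 * b 1 + a 5 * b 0, ?_⟩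
  rw [BC_eq]
  simp only [h, hb]
  push_cast
  ring

theorem tau_fix (u : Fin 6 → ℚ) : pC (tauC u) = pC u ↔ ∃ n : ℤ, u 2 - u 3 = n := by
  rw [pC_eq]
  constructor
  · intro h
    simpa [tauC] using h 2
  · rintro ⟨n, hn⟩ i
    fin_cases i
    · exact ⟨0, by simp [tauC, Equiv.swap_apply_def]⟩
    · exact ⟨0, by simp [tauC, Equiv.swap_apply_def]⟩
    · exact ⟨n, by simpa [tauC] using hn⟩
    · exact ⟨-n, by simp [tauC]; linarith⟩
    · exact ⟨0, by simp [tauC, Equiv.swap_apply_def]⟩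
    · exact ⟨0, by simp [tauC, Equiv.swap_apply_def]⟩

theorem order_two (e : Fin 6 → Fin 2) (he : e ∈ EC) : addOrderOf (pC (halfC e)) = 2 := by
  apply addOrderOf_eq_prime
  · have : 2 • pC (halfC e) = pC (2 • halfC e) := rfl
    rw [this]
    have h0 : (0 : QC) = pC 0 := rfl
    rw [h0, pC_eq]
    intro i
    exact ⟨-((e i : ℕ) : ℤ), by simp [halfC]; ring⟩
  · intro h
    have h0 : pC (halfC e) = pC (halfC 0) := by
      rw [h]
      have : halfC 0 = 0 := by funext i; simp [halfC]
      rw [this]; rfl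
    have := halfC_inj h0
    subst this
    revert he
    decide +kernel

/-- Signed numerators of a norm-one representative. -/
def repC (e : Fin 6 → Fin 2) : Fin 6 → ℤ := fun i =>
  if i = 5 ∧ e 2 = 1 ∧ e 0 = 1 ∧ e 1 = 1 ∧ e 4 = 1 then -((e 5 : ℕ) : ℤ) else ((e i : ℕ) : ℤ)

theorem repC_norm : ∀ e ∈ EC, 2 * (repC e 0 * repC e 5 + repC e 1 * repC e 4) +
    repC e 2 ^ 2 + repC e 3 ^ 2 = 2 := by
  decide +kernel

theorem repC_mod : ∀ e ∈ EC, ∀ i, 2 ∣ ((e i : ℕ) : ℤ) - repC e i := by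
  decide +kernel

theorem repC_tau : ∀ e ∈ EC, repC e 2 = repC e 3 := by
  decide +kernel

theorem parity_aux (a : Fin 6 → ℤ) (h23 : 2 ∣ a 2 - a 3)
    (h : 2 * (a 0 * a 5 + a 1 * a 4) + a 2 ^ 2 + a 3 ^ 2 = 2) :
    (a 0 * a 5 + a 1 * a 4 + a 2) % 2 = 1 := by
  obtain ⟨k, hk⟩ := h23
  have h3 : a 3 = a 2 - 2 * k := by linarith
  rw [h3] at h
  have h4 : a 0 * a 5 + a 1 * a 4 = 1 - a 2 ^ 2 + 2 * (a 2 * k - k ^ 2) := by linarith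
  have h5 : (a 2 * (a 2 - 1)) % 2 = 0 := Int.even_iff.1 (Int.even_mul_pred_self _)
  have h6 : a 0 * a 5 + a 1 * a 4 + a 2 = 1 - a 2 * (a 2 - 1) + 2 * (a 2 * k - k ^ 2) := by
    rw [h4]; ring
  rw [h6]
  omega

theorem T16_eq : T16 = (fun e => pC (halfC e)) '' (EC : Set (Fin 6 → Fin 2)) := by
  ext c
  constructor
  · rintro ⟨u, hu, rfl, -, ht, hB⟩
    choose a ha using dual_half u hu
    obtain ⟨n, hn⟩ := (tau_fix u).1 ht
    rw [ha, ha] at hn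
    have h23 : 2 ∣ a 2 - a 3 := ⟨n, by
      have : (a 2 : ℚ) - a 3 = 2 * n := by linarith
      exact_mod_cast this⟩
    rw [BC_eq] at hB
    simp only [ha] at hB
    have hN : 2 * (a 0 * a 5 + a 1 * a 4) + a 2 ^ 2 + a 3 ^ 2 = 2 := by
      have : 2 * ((a 0 : ℚ) * a 5 + a 1 * a 4) + a 2 ^ 2 + a 3 ^ 2 = 2 := by linarith
      exact_mod_cast this
    have hp := parity_aux a h23 hN
    have hc : ((a 0 * a 5 + a 1 * a 4 + a 2 : ℤ) : ZMod 2) = ((1 : ℤ) : ZMod 2) :=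
      (ZMod.intCast_eq_intCast_iff _ _ 2).2 hp
    have hd : ((a 2 : ℤ) : ZMod 2) = ((a 3 : ℤ) : ZMod 2) :=
      ((ZMod.intCast_eq_intCast_iff_dvd_sub _ _ 2).2 (by exact_mod_cast h23)).symm
    push_cast at hc
    refine ⟨fun i => ((a i : ℤ) : ZMod 2), ?_, ?_⟩
    · simp only [EC, Finset.coe_filter, Finset.mem_univ, true_and, Set.mem_setOf_eq]
      exact ⟨hd, hc⟩
    · show pC _ = pC u
      rw [pC_eq]
      intro i
      refine ⟨a i / 2, ?_⟩
      have h1 : (((a i : ZMod 2).val : ℕ) : ℤ) = a i % 2 := ZMod.val_intCast (n := 2) (a i)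
      have h2 : (a i : ℚ) = 2 * ((a i / 2 : ℤ) : ℚ) + (((a i : ZMod 2).val : ℕ) : ℚ) := by
        have : a i = 2 * (a i / 2) + (((a i : ZMod 2).val : ℕ) : ℤ) := by rw [h1]; omega
        exact_mod_cast this
      show u i - (((a i : ZMod 2).val : ℕ) : ℚ) / 2 = _
      rw [ha]
      linarith
  · rintro ⟨e, he, rfl⟩
    have he : e ∈ EC := he
    have hp : pC (fun i => (repC e i : ℚ) / 2) = pC (halfC e) := by
      rw [pC_eq]
      intro i
      obtain ⟨k, hk⟩ := repC_mod e he i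
      refine ⟨k, ?_⟩
      have : (((e i : ℕ) : ℚ)) - repC e i = 2 * k := by exact_mod_cast hk
      simp only [halfC]
      linarith
    refine ⟨fun i => (repC e i : ℚ) / 2, half_dual _ (repC e) (fun _ => rfl), hp,
      order_two e he, ?_, ?_⟩
    · show _ = pC (halfC e)
      rw [← hp, tau_fix]
      exact ⟨0, by simp [repC_tau e he]⟩
    · rw [BC_eq]
      have : 2 * ((repC e 0 : ℚ) * repC e 5 + repC e 1 * repC e 4) + repC e 2 ^ 2
          + repC e 3 ^ 2 = 2 := by exact_mod_cast repC_norm e he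
      linarith

theorem T16_ncard : T16.ncard = 16 := by
  rw [T16_eq, Set.ncard_image_of_injective _ halfC_inj, Set.ncard_coe_finset, EC_card]

theorem mem_T16 : pC ![0, 0, 1/2, 1/2, 0, 0] ∈ T16 := by
  rw [T16_eq]
  refine ⟨![0, 0, 1, 1, 0, 0], ?_, ?_⟩
  · show _ ∈ EC
    decide +kernel
  · show pC _ = pC _
    congr 1
    funext i
    fin_cases i <;> simp [halfC]

/-- There are exactly 16 such cosets; one of them is the coset of
`(0, 0, 1/2, 1/2, 0, 0)`, so exactly 15 of them differ from that coset. -/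
theorem statement16 :
    T16.ncard = 16 ∧ pC ![0, 0, 1/2, 1/2, 0, 0] ∈ T16 ∧
    (T16 \ {pC ![0, 0, 1/2, 1/2, 0, 0]}).ncard = 15 := by
  refine ⟨T16_ncard, mem_T16, ?_⟩
  rw [Set.ncard_sdiff_singleton_of_mem mem_T16, T16_ncard]

end
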